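/- Assume the functions {x ↦ exp(αᵀx)}_{α∈𝒜} are linearly independent on X. If the set Λ_X(𝒜) of normalized X-circuits of 𝒜 is empty, then C_X(𝒜) = ℝ^𝒜₊ (the nonnegative orthant). Otherwise, C_X(𝒜) = cl( conv( ∪_{λ ∈ Λ*_X(𝒜)} C_X(𝒜,λ) ) ), where Λ*_X(𝒜) is the set of reduced normalized X-circuits of 𝒜. -/

import Mathlib

open Finset

/-- Dot product on `Fin n → ℝ`. -/
noncomputable def dotp {n : ℕ} (y x : Fin n → ℝ) : ℝ := ∑ i, y i * x i

/-- Support function `σ_X : ℝⁿ → ℝ ∪ {±∞}` of a set `X ⊆ ℝⁿ`. -/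
noncomputable def suppFn {n : ℕ} (X : Set (Fin n → ℝ)) (y : Fin n → ℝ) : EReal :=
  ⨆ x ∈ X, ((dotp y x : ℝ) : EReal)

/-- The linear map `𝒜 : ℝ^𝒜 → ℝⁿ`, `ν ↦ Σ_α ν_α α`. -/
noncomputable def Amap {n m : ℕ} (A : Fin m → Fin n → ℝ) (ν : Fin m → ℝ) : Fin n → ℝ :=
  fun j => ∑ i, ν i * A i j

/-- `N_β = {ν : ν_α ≥ 0 (α ≠ β), Σ ν_α = 0}`. -/
def Nbeta {m : ℕ} (b : Fin m) : Set (Fin m → ℝ) :=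
  {ν | (∀ i, i ≠ b → 0 ≤ ν i) ∧ ∑ i, ν i = 0}

/-- Two vectors are proportional if one is a scalar multiple of the other. -/
def Proportional {m : ℕ} (u v : Fin m → ℝ) : Prop :=
  ∃ t : ℝ, u = t • v ∨ v = t • u

/-- The augmented support function `ν ↦ σ_X(-𝒜ν)`. -/
noncomputable def sigA {n m : ℕ} (X : Set (Fin n → ℝ)) (A : Fin m → Fin n → ℝ)
    (ν : Fin m → ℝ) : EReal :=
  suppFn X (-(Amap A ν))

/-- The map `ν ↦ σ_X(-𝒜ν)` is affine on the segment `[ν1, ν2]`. -/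
def SigmaAffineOnSeg {n m : ℕ} (X : Set (Fin n → ℝ)) (A : Fin m → Fin n → ℝ)
    (ν1 ν2 : Fin m → ℝ) : Prop :=
  ∀ t : ℝ, t ∈ Set.Icc (0:ℝ) 1 →
    sigA X A (t • ν1 + (1 - t) • ν2) =
      (t : EReal) * sigA X A ν1 + ((1 - t : ℝ) : EReal) * sigA X A ν2

/-- `ν` is an `X`-circuit of `𝒜` (with negative index allowed only at `b`). -/
def IsXCircuit {n m : ℕ} (X : Set (Fin n → ℝ)) (A : Fin m → Fin n → ℝ)
    (b : Fin m) (ν : Fin m → ℝ) : Prop :=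
  ν ∈ Nbeta b ∧ ν ≠ 0 ∧ sigA X A ν < ⊤ ∧
  ¬ ∃ (ν1 ν2 : Fin m → ℝ) (θ : ℝ), ν1 ∈ Nbeta b ∧ ν2 ∈ Nbeta b ∧
      ¬ Proportional ν1 ν2 ∧ θ ∈ Set.Ioo (0:ℝ) 1 ∧
      ν = θ • ν1 + (1 - θ) • ν2 ∧ SigmaAffineOnSeg X A ν1 ν2

/-- All finite nonnegative combinations of elements of `S` (including `0`). -/
def coneHull {E : Type*} [AddCommMonoid E] [SMul ℝ E] (S : Set E) : Set E :=
  {x | ∃ (k : ℕ) (t : Fin k → ℝ) (v : Fin k → E),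
    (∀ j, 0 ≤ t j) ∧ (∀ j, v j ∈ S) ∧ x = ∑ j, t j • v j}

/-- `v` is an edge generator of the convex cone `K`. -/
def IsEdgeGenerator {E : Type*} [AddCommMonoid E] [SMul ℝ E] (K : Set E) (v : E) : Prop :=
  v ≠ 0 ∧ v ∈ K ∧ ∀ u ∈ K, ∀ w ∈ K, v = u + w →
    (∃ a : ℝ, 0 ≤ a ∧ u = a • v) ∧ (∃ b : ℝ, 0 ≤ b ∧ w = b • v)

/-- The `X`-AGE cone `C_X(𝒜, β)`, as a cone of coefficient vectors. -/
def AgeCone {n m : ℕ} (X : Set (Fin n → ℝ)) (A : Fin m → Fin n → ℝ) (b : Fin m) :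
    Set (Fin m → ℝ) :=
  {c | (∀ i, i ≠ b → 0 ≤ c i) ∧ ∀ x ∈ X, 0 ≤ ∑ i, c i * Real.exp (dotp (A i) x)}

/-- The `X`-SAGE cone `C_X(𝒜) = Σ_β C_X(𝒜, β)`. -/
def Sage {n m : ℕ} (X : Set (Fin n → ℝ)) (A : Fin m → Fin n → ℝ) : Set (Fin m → ℝ) :=
  {c | ∃ f : Fin m → (Fin m → ℝ), (∀ b, f b ∈ AgeCone X A b) ∧ c = ∑ b, f b}

/-- One summand of the relative entropy, with the conventions `0·log 0 = 0` and
`D = ∞` if `a > 0` while `c ≤ 0`. -/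
noncomputable def relEnt (a c : ℝ) : EReal :=
  if a = 0 then 0 else if 0 < c then ((a * Real.log (a / c) : ℝ) : EReal) else ⊤

/-- The relative entropy `D(ν_{∖β}, e · c_{∖β})`. -/
noncomputable def relEntSum {m : ℕ} (b : Fin m) (ν c : Fin m → ℝ) : EReal :=
  ∑ i ∈ Finset.univ.erase b, relEnt (ν i) (Real.exp 1 * c i)

/-- Condition (★): `ν ∈ N_β`, `ν ≠ 0`, `σ_X(-𝒜ν) + D(ν_{∖β}, e c_{∖β}) ≤ c_β`. -/
def StarCond {n m : ℕ} (X : Set (Fin n → ℝ)) (A : Fin m → Fin n → ℝ)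
    (b : Fin m) (c ν : Fin m → ℝ) : Prop :=
  ν ∈ Nbeta b ∧ ν ≠ 0 ∧ sigA X A ν + relEntSum b ν c ≤ (c b : EReal)

/-- The `λ`-witnessed AGE cone `C_X(𝒜, λ)` for a normalized `λ` with `λ_β = -1`. -/
noncomputable def WitnessCone {n m : ℕ} (X : Set (Fin n → ℝ)) (A : Fin m → Fin n → ℝ)
    (b : Fin m) (l : Fin m → ℝ) : Set (Fin m → ℝ) :=
  {c | (∀ i, i ≠ b → 0 ≤ c i) ∧
    (-(c b)) * Real.exp ((sigA X A l).toReal) ≤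
      ∏ i ∈ Finset.univ.filter (fun i => 0 < l i), (c i / l i) ^ (l i)}

/-- Normalized `X`-circuits in `N_β`. -/
def LambdaB {n m : ℕ} (X : Set (Fin n → ℝ)) (A : Fin m → Fin n → ℝ) (b : Fin m) :
    Set (Fin m → ℝ) :=
  {l | IsXCircuit X A b l ∧ l b = -1}

/-- All normalized `X`-circuits of `𝒜`. -/
def Lambda {n m : ℕ} (X : Set (Fin n → ℝ)) (A : Fin m → Fin n → ℝ) : Set (Fin m → ℝ) :=
  ⋃ b, LambdaB X A b

/-- Functional form `φ_λ = (λ, σ_X(-𝒜λ)) ∈ ℝ^𝒜 × ℝ`. -/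
noncomputable def phiVec {n m : ℕ} (X : Set (Fin n → ℝ)) (A : Fin m → Fin n → ℝ)
    (l : Fin m → ℝ) : (Fin m → ℝ) × ℝ :=
  (l, (sigA X A l).toReal)

/-- Functional form as an affine function `φ_λ(y) = Σ y_α λ_α + σ_X(-𝒜λ)`. -/
noncomputable def phiFun {n m : ℕ} (X : Set (Fin n → ℝ)) (A : Fin m → Fin n → ℝ)
    (l : Fin m → ℝ) (y : Fin m → ℝ) : ℝ :=
  (∑ i, y i * l i) + (sigA X A l).toReal

/-- The circuit graph `G_X(𝒜)`. -/
noncomputable def circuitGraph {n m : ℕ} (X : Set (Fin n → ℝ)) (A : Fin m → Fin n → ℝ) :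
    Set ((Fin m → ℝ) × ℝ) :=
  coneHull ((phiVec X A '' Lambda X A) ∪ {((0 : Fin m → ℝ), (1 : ℝ))})

/-- The reduced normalized `X`-circuits `Λ*_X(𝒜)`. -/
noncomputable def LambdaStar {n m : ℕ} (X : Set (Fin n → ℝ)) (A : Fin m → Fin n → ℝ) :
    Set (Fin m → ℝ) :=
  {l | l ∈ Lambda X A ∧ IsEdgeGenerator (circuitGraph X A) (phiVec X A l)}

/-- `λ`-witnessed AGE cone for a normalized circuit, with `β` recovered from `λ`. -/
noncomputable def WitnessConeL {n m : ℕ} (X : Set (Fin n → ℝ)) (A : Fin m → Fin n → ℝ)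
    (l : Fin m → ℝ) : Set (Fin m → ℝ) :=
  ⋃ b ∈ {b : Fin m | l b = -1}, WitnessCone X A b l

/-- Dual cone of a set of coefficient vectors in `ℝ^𝒜`. -/
def dualConeV {m : ℕ} (K : Set (Fin m → ℝ)) : Set (Fin m → ℝ) :=
  {v | ∀ c ∈ K, 0 ≤ ∑ i, v i * c i}

/-- Dual cone of a subset of `ℝ^𝒜 × ℝ`. -/
def dualConeP {m : ℕ} (K : Set ((Fin m → ℝ) × ℝ)) : Set ((Fin m → ℝ) × ℝ) :=
  {p | ∀ q ∈ K, 0 ≤ (∑ i, p.1 i * q.1 i) + p.2 * q.2}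

/-- The basis functions `x ↦ exp(αᵀx)`, `α ∈ 𝒜`, are linearly independent on `X`. -/
def ExpLinIndep {n m : ℕ} (X : Set (Fin n → ℝ)) (A : Fin m → Fin n → ℝ) : Prop :=
  LinearIndependent ℝ (fun i : Fin m => fun x : X => Real.exp (dotp (A i) (x : Fin n → ℝ)))

/-- `X` is a polyhedron: an intersection of finitely many closed halfspaces. -/
def IsPolyhedron {n : ℕ} (X : Set (Fin n → ℝ)) : Prop :=
  ∃ (k : ℕ) (a : Fin k → Fin n → ℝ) (bb : Fin k → ℝ),
    X = {x | ∀ i, dotp (a i) x ≤ bb i}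

/-- Minkowski sum `Σ_{l ∈ Λ} C(l)` (finite sums, one summand per `l`;
the empty sum gives `{0}`). -/
def MinkSumOver {m : ℕ} (Λ : Set (Fin m → ℝ)) (C : (Fin m → ℝ) → Set (Fin m → ℝ)) :
    Set (Fin m → ℝ) :=
  {c | ∃ (s : Finset (Fin m → ℝ)) (f : (Fin m → ℝ) → (Fin m → ℝ)),
    (↑s ⊆ Λ) ∧ (∀ l ∈ s, f l ∈ C l) ∧ c = ∑ l ∈ s, f l}

/-- A closed convex cone containing the origin. -/
structure IsClosedCone {E : Type*} [NormedAddCommGroup E] [NormedSpace ℝ E] (K : Set E) :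
    Prop where
  closed : IsClosed K
  zero : (0 : E) ∈ K
  add : ∀ u ∈ K, ∀ w ∈ K, u + w ∈ K
  smul : ∀ t : ℝ, 0 ≤ t → ∀ u ∈ K, t • u ∈ K

/-- The Minkowski sum of a finite family of sets. -/
def coneSum {ι E : Type*} [Fintype ι] [AddCommMonoid E] (K : ι → Set E) : Set E :=
  {p | ∃ f : ι → E, (∀ i, f i ∈ K i) ∧ p = ∑ i, f i}

section Cones

variable {E : Type*} [NormedAddCommGroup E] [NormedSpace ℝ E]

lemma IsClosedCone.sum_mem {ι : Type*} {K : Set E} (hK : IsClosedCone K) (s : Finset ι)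
    (f : ι → E) (hf : ∀ i ∈ s, f i ∈ K) : ∑ i ∈ s, f i ∈ K :=
  Finset.sum_induction f (· ∈ K) (fun u w hu hw => hK.add u hu w hw) hK.zero hf

lemma IsClosedCone.convex {K : Set E} (hK : IsClosedCone K) : Convex ℝ K := by
  intro x hx y hy a b ha hb _
  exact hK.add _ (hK.smul a ha x hx) _ (hK.smul b hb y hy)

lemma IsClosedCone.nonneg_of_pos {K : Set E} {ℓ : E →L[ℝ] ℝ}
    (hpos : ∀ p ∈ K, p ≠ 0 → 0 < ℓ p) {p : E} (hp : p ∈ K) : 0 ≤ ℓ p := by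
  by_cases h : p = 0
  · simp [h]
  · exact (hpos p hp h).le

/-- A functional that is positive on a closed cone controls the norm on that cone. -/
lemma IsClosedCone.exists_norm_le [ProperSpace E] {K : Set E} (hK : IsClosedCone K)
    (ℓ : E →L[ℝ] ℝ) (hpos : ∀ p ∈ K, p ≠ 0 → 0 < ℓ p) :
    ∃ C : ℝ, 0 ≤ C ∧ ∀ p ∈ K, ‖p‖ ≤ C * ℓ p := by
  have hcomp : IsCompact (K ∩ Metric.sphere (0 : E) 1) :=
    (isCompact_sphere (0 : E) 1).inter_left hK.closed
  have hunit : ∀ p ∈ K, p ≠ 0 → ‖p‖⁻¹ • p ∈ K ∩ Metric.sphere (0 : E) 1 := by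
    intro p hp h0
    refine ⟨hK.smul _ (by positivity) p hp, ?_⟩
    simp [norm_smul, h0]
  rcases (K ∩ Metric.sphere (0 : E) 1).eq_empty_or_nonempty with he | hne
  · refine ⟨0, le_rfl, fun p hp => ?_⟩
    by_cases h0 : p = 0
    · simp [h0]
    · exact absurd (hunit p hp h0) (by simp [he])
  · obtain ⟨q, hq, hmin⟩ := hcomp.exists_isMinOn hne ℓ.continuous.continuousOn
    have hq0 : q ≠ 0 := by
      rintro rfl
      simpa using hq.2
    have hℓq := hpos q hq.1 hq0
    refine ⟨(ℓ q)⁻¹, by positivity, fun p hp => ?_⟩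
    by_cases h0 : p = 0
    · simp [h0]
    · have h1 : ℓ q ≤ ℓ (‖p‖⁻¹ • p) := hmin (hunit p hp h0)
      have hn : 0 < ‖p‖ := norm_pos_iff.2 h0
      rw [map_smul, smul_eq_mul, inv_mul_eq_div, le_div_iff₀ hn] at h1
      rw [inv_mul_eq_div, le_div_iff₀ hℓq]
      linarith

lemma subset_coneSum {ι : Type*} [Fintype ι] {K : ι → Set E}
    (hK : ∀ i, IsClosedCone (K i)) (i : ι) : K i ⊆ coneSum K := by
  classical
  intro p hp
  refine ⟨Pi.single i p, fun j => ?_, by simp⟩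
  by_cases h : j = i
  · subst h; simpa using hp
  · simpa [h] using (hK j).zero

lemma coneSum_pos {ι : Type*} [Fintype ι] {K : ι → Set E}
    (ℓ : E →L[ℝ] ℝ) (hpos : ∀ i, ∀ p ∈ K i, p ≠ 0 → 0 < ℓ p) :
    ∀ p ∈ coneSum K, p ≠ 0 → 0 < ℓ p := by
  rintro p ⟨f, hf, rfl⟩ h0
  rw [map_sum]
  obtain ⟨i, -, hi⟩ := Finset.exists_ne_zero_of_sum_ne_zero h0
  exact Finset.sum_pos' (fun j _ => IsClosedCone.nonneg_of_pos (hpos j) (hf j))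
    ⟨i, Finset.mem_univ i, hpos i _ (hf i) hi⟩

/-- A finite sum of closed cones on which a common functional is positive is closed. -/
lemma isClosedCone_coneSum [ProperSpace E] {ι : Type*} [Fintype ι] {K : ι → Set E}
    (hK : ∀ i, IsClosedCone (K i)) (ℓ : E →L[ℝ] ℝ)
    (hpos : ∀ i, ∀ p ∈ K i, p ≠ 0 → 0 < ℓ p) : IsClosedCone (coneSum K) where
  zero := ⟨0, fun i => (hK i).zero, by simp⟩
  add := by
    rintro _ ⟨f, hf, rfl⟩ _ ⟨g, hg, rfl⟩
    exact ⟨f + g, fun i => (hK i).add _ (hf i) _ (hg i), by simp [Finset.sum_add_distrib]⟩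
  smul := by
    rintro t ht _ ⟨f, hf, rfl⟩
    exact ⟨t • f, fun i => (hK i).smul t ht _ (hf i), by simp [Finset.smul_sum]⟩
  closed := by
    choose C hC hCle using fun i => (hK i).exists_norm_le ℓ (hpos i)
    refine IsSeqClosed.isClosed ?_
    intro u p hu hup
    choose f hf hfu using hu
    have hlim : Filter.Tendsto (fun k => ℓ (u k)) Filter.atTop (nhds (ℓ p)) :=
      (ℓ.continuous.tendsto p).comp hup
    obtain ⟨M, hM⟩ := hlim.bddAbove_range
    have hbound : ∀ k i, ‖f k i‖ ≤ C i * M := by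
      intro k i
      have h1 : ℓ (f k i) ≤ ℓ (u k) := by
        rw [hfu, map_sum]
        exact Finset.single_le_sum (f := fun i => ℓ (f k i))
          (fun j _ => IsClosedCone.nonneg_of_pos (hpos j) (hf k j)) (Finset.mem_univ i)
      have h2 : ℓ (u k) ≤ M := hM ⟨k, rfl⟩
      exact (hCle i _ (hf k i)).trans (mul_le_mul_of_nonneg_left (h1.trans h2) (hC i))
    have hcomp : IsCompact (Set.pi Set.univ fun i => Metric.closedBall (0 : E) (C i * M)) :=
      isCompact_univ_pi fun i => isCompact_closedBall _ _
    obtain ⟨g, -, φ, hφ, hg⟩ := hcomp.tendsto_subseq (x := f)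
      (fun k i _ => by simpa using hbound k i)
    rw [tendsto_pi_nhds] at hg
    refine ⟨g, fun i => (hK i).closed.mem_of_tendsto (hg i)
      (Filter.Eventually.of_forall fun k => hf _ i), ?_⟩
    refine tendsto_nhds_unique (hup.comp hφ.tendsto_atTop) ?_
    have : u ∘ φ = fun k => ∑ i, f (φ k) i := by
      funext k; exact hfu _
    rw [this]
    exact tendsto_finsetSum _ fun i _ => hg i

/-- If a functional is negative somewhere on a pointed closed cone, then it is negative on an
extreme ray. -/
lemma IsClosedCone.exists_isEdgeGenerator [ProperSpace E] {K : Set E} (hK : IsClosedCone K)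
    (ℓ g : E →L[ℝ] ℝ) (hpos : ∀ p ∈ K, p ≠ 0 → 0 < ℓ p) {q : E} (hq : q ∈ K) (hgq : g q < 0) :
    ∃ p, IsEdgeGenerator K p ∧ g p < 0 := by
  obtain ⟨C, hC, hCle⟩ := hK.exists_norm_le ℓ hpos
  set B : Set E := K ∩ {p | ℓ p = 1} with hB
  have hBc : IsCompact B := by
    refine (isCompact_closedBall (0 : E) C).of_isClosed_subset
      (hK.closed.inter (isClosed_eq ℓ.continuous continuous_const)) ?_
    rintro p ⟨hp, hp1⟩
    have := hCle p hp
    rw [Set.mem_ofPred_eq] at hp1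
    simpa [hp1] using this
  have hnorm : ∀ p ∈ K, p ≠ 0 → (ℓ p)⁻¹ • p ∈ B := by
    intro p hp h0
    have := hpos p hp h0
    exact ⟨hK.smul _ (by positivity) p hp, by simp [this.ne']⟩
  have hq0 : q ≠ 0 := by
    rintro rfl
    simp at hgq
  have hqB := hnorm q hq hq0
  have hexp : IsExposed ℝ B {x ∈ B | ∀ y ∈ B, (-g) y ≤ (-g) x} := fun _ => ⟨-g, rfl⟩
  obtain ⟨r, hr, hrmin⟩ := hBc.exists_isMinOn ⟨_, hqB⟩ g.continuous.continuousOn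
  obtain ⟨p, hp⟩ := (hexp.isCompact hBc).extremePoints_nonempty
    ⟨r, hr, fun y hy => by simpa using hrmin hy⟩
  have hpF := hp.1
  have hpE := hexp.isExtreme.extremePoints_subset_extremePoints hp
  have hpB : p ∈ B := hpF.1
  have hp1 : ℓ p = 1 := hpB.2
  have hgp : g p < 0 := by
    have h1 : g p ≤ g ((ℓ q)⁻¹ • q) := by simpa using hpF.2 _ hqB
    have h2 : g ((ℓ q)⁻¹ • q) < 0 := by
      rw [map_smul, smul_eq_mul]
      exact mul_neg_of_pos_of_neg (inv_pos.2 (hpos q hq hq0)) hgq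
    linarith
  have hp0 : p ≠ 0 := by
    rintro rfl
    simp at hgp
  have hsplit : ∀ u ∈ K, ∀ w ∈ K, p = u + w → u ≠ 0 → w ≠ 0 → u = ℓ u • p := by
    intro u hu w hw huw hu0 hw0
    have hlu := hpos u hu hu0
    have hlw := hpos w hw hw0
    have hs : ℓ u + ℓ w = 1 := by rw [← map_add, ← huw, hp1]
    have hseg : p ∈ openSegment ℝ ((ℓ u)⁻¹ • u) ((ℓ w)⁻¹ • w) := by
      refine ⟨ℓ u, ℓ w, hlu, hlw, hs, ?_⟩
      rw [smul_inv_smul₀ hlu.ne', smul_inv_smul₀ hlw.ne', huw]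
    have := hpE.2 (hnorm u hu hu0) (hnorm w hw hw0) hseg
    rw [← this, smul_inv_smul₀ hlu.ne']
  refine ⟨p, ⟨hp0, hpB.1, fun u hu w hw huw => ?_⟩, hgp⟩
  by_cases hu0 : u = 0
  · exact ⟨⟨0, le_rfl, by simp [hu0]⟩, ⟨1, zero_le_one, by simp [huw, hu0]⟩⟩
  by_cases hw0 : w = 0
  · exact ⟨⟨1, zero_le_one, by simp [huw, hw0]⟩, ⟨0, le_rfl, by simp [hw0]⟩⟩
  exact ⟨⟨ℓ u, (hpos u hu hu0).le, hsplit u hu w hw huw hu0 hw0⟩,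
    ⟨ℓ w, (hpos w hw hw0).le, hsplit w hw u hu (by rw [huw, add_comm]) hw0 hu0⟩⟩

/-- An edge generator of a sum of cones lies in one of the summands. -/
lemma IsEdgeGenerator.mem_summand {ι : Type*} [Fintype ι] {K : ι → Set E}
    (hK : ∀ i, IsClosedCone (K i)) {p : E} (hp : IsEdgeGenerator (coneSum K) p) :
    ∃ i, p ∈ K i := by
  classical
  obtain ⟨hp0, ⟨f, hf, hpf⟩, hsplit⟩ := hp
  obtain ⟨i, -, hi⟩ := Finset.exists_ne_zero_of_sum_ne_zero (hpf ▸ hp0 : ∑ i, f i ≠ 0)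
  refine ⟨i, ?_⟩
  have hrest : p - f i ∈ coneSum K := by
    refine ⟨Function.update f i 0, fun j => ?_, ?_⟩
    · by_cases h : j = i
      · subst h; simpa using (hK j).zero
      · simpa [h] using hf j
    · rw [Finset.sum_update_of_mem (Finset.mem_univ i), hpf, zero_add,
        ← Finset.add_sum_erase _ _ (Finset.mem_univ i), Finset.sdiff_singleton_eq_erase]
      abel
  obtain ⟨⟨a, ha, hfa⟩, -⟩ := hsplit (f i) (subset_coneSum hK i (hf i)) _ hrest (by abel)
  have ha0 : a ≠ 0 := by
    rintro rfl
    exact hi (by simpa using hfa)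
  have : p = a⁻¹ • f i := by rw [hfa, inv_smul_smul₀ ha0]
  rw [this]
  exact (hK i).smul _ (by positivity) _ (hf i)

end Cones

lemma IsEdgeGenerator.smul {E : Type*} [NormedAddCommGroup E] [NormedSpace ℝ E] {K : Set E}
    (hK : IsClosedCone K) {v : E} (hv : IsEdgeGenerator K v) {t : ℝ} (ht : 0 < t) :
    IsEdgeGenerator K (t • v) := by
  obtain ⟨h0, hmem, h⟩ := hv
  refine ⟨smul_ne_zero ht.ne' h0, hK.smul t ht.le v hmem, fun u hu w hw huw => ?_⟩
  have hsum : v = t⁻¹ • u + t⁻¹ • w := by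
    rw [← smul_add, ← huw, inv_smul_smul₀ ht.ne']
  obtain ⟨⟨a, ha, hua⟩, ⟨b, hb, hwb⟩⟩ :=
    h _ (hK.smul _ (by positivity) u hu) _ (hK.smul _ (by positivity) w hw) hsum
  refine ⟨⟨a, ha, ?_⟩, ⟨b, hb, ?_⟩⟩
  · rw [smul_comm, ← hua, smul_inv_smul₀ ht.ne']
  · rw [smul_comm, ← hwb, smul_inv_smul₀ ht.ne']

lemma IsEdgeGenerator.mono {E : Type*} [AddCommMonoid E] [SMul ℝ E] {K L : Set E} {v : E}
    (hv : IsEdgeGenerator K v) (hLK : L ⊆ K) (hvL : v ∈ L) : IsEdgeGenerator L v :=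
  ⟨hv.1, hvL, fun u hu w hw => hv.2.2 u (hLK hu) w (hLK hw)⟩

section Signomials

variable {n m : ℕ} {X : Set (Fin n → ℝ)} {A : Fin m → Fin n → ℝ}

/-- The epigraph of `ν ↦ σ_X(-𝒜ν)` over `N_β`. -/
def epiCone (X : Set (Fin n → ℝ)) (A : Fin m → Fin n → ℝ) (b : Fin m) :
    Set ((Fin m → ℝ) × ℝ) :=
  {p | p.1 ∈ Nbeta b ∧ ∀ x ∈ X, 0 ≤ ∑ i, p.1 i * dotp (A i) x + p.2}

/-- The functional `c ↦ Σ w_α c_α`. -/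
noncomputable def coeffPairing (w : Fin m → ℝ) : (Fin m → ℝ) →L[ℝ] ℝ :=
  LinearMap.toContinuousLinearMap (Fintype.linearCombination ℝ w)

@[simp]
lemma coeffPairing_apply (w c : Fin m → ℝ) : coeffPairing w c = ∑ i, c i * w i := by
  simp [coeffPairing, Fintype.linearCombination_apply]

lemma eq_coeffPairing (f : (Fin m → ℝ) →L[ℝ] ℝ) :
    f = coeffPairing fun i => f (Pi.single i 1) := by
  ext z
  rw [coeffPairing_apply]
  conv_lhs => rw [pi_eq_sum_univ' z, map_sum]
  refine Finset.sum_congr rfl fun i _ => ?_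
  rw [map_smul, smul_eq_mul]

lemma single_one_nonneg (i j : Fin m) : (0 : ℝ) ≤ (Pi.single i 1 : Fin m → ℝ) j := by
  by_cases h : j = i
  · subst h; simp
  · simp [h]

/-- The functional `(ν, t) ↦ Σ y_α ν_α + t`. -/
noncomputable def graphPairing (y : Fin m → ℝ) : ((Fin m → ℝ) × ℝ) →L[ℝ] ℝ :=
  (coeffPairing y).coprod (ContinuousLinearMap.id ℝ ℝ)

@[simp]
lemma graphPairing_apply (y : Fin m → ℝ) (p : (Fin m → ℝ) × ℝ) :
    graphPairing y p = ∑ i, p.1 i * y i + p.2 := by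
  simp [graphPairing]

lemma dotp_neg_Amap (A : Fin m → Fin n → ℝ) (ν : Fin m → ℝ) (x : Fin n → ℝ) :
    dotp (-(Amap A ν)) x = -∑ i, ν i * dotp (A i) x := by
  simp only [dotp, Amap, Pi.neg_apply, neg_mul, Finset.sum_neg_distrib, Finset.sum_mul,
    Finset.mul_sum]
  rw [Finset.sum_comm]
  simp only [mul_assoc]

lemma sigA_le_iff {ν : Fin m → ℝ} {s : ℝ} :
    sigA X A ν ≤ (s : EReal) ↔ ∀ x ∈ X, 0 ≤ ∑ i, ν i * dotp (A i) x + s := by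
  simp only [sigA, suppFn, iSup_le_iff, EReal.coe_le_coe_iff, dotp_neg_Amap]
  refine forall₂_congr fun x _ => ?_
  constructor <;> intro h <;> linarith

lemma sigA_ne_bot (hX : X.Nonempty) (ν : Fin m → ℝ) : sigA X A ν ≠ ⊥ := by
  obtain ⟨x, hx⟩ := hX
  have h : ((dotp (-(Amap A ν)) x : ℝ) : EReal) ≤ sigA X A ν :=
    le_iSup₂ (f := fun x (_ : x ∈ X) => ((dotp (-(Amap A ν)) x : ℝ) : EReal)) x hx
  intro hb
  rw [hb] at h
  exact EReal.coe_ne_bot _ (le_bot_iff.1 h)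

lemma coe_toReal_sigA (hX : X.Nonempty) {ν : Fin m → ℝ} (h : sigA X A ν < ⊤) :
    ((sigA X A ν).toReal : EReal) = sigA X A ν :=
  EReal.coe_toReal h.ne (sigA_ne_bot hX ν)

lemma phiVec_mem_epiCone (hX : X.Nonempty) {b : Fin m} {ν : Fin m → ℝ} (hν : ν ∈ Nbeta b)
    (h : sigA X A ν < ⊤) : phiVec X A ν ∈ epiCone X A b :=
  ⟨hν, sigA_le_iff.1 (coe_toReal_sigA hX h).ge⟩

lemma vertical_mem_epiCone (b : Fin m) {t : ℝ} (ht : 0 ≤ t) :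
    ((0 : Fin m → ℝ), t) ∈ epiCone X A b :=
  ⟨⟨by simp, by simp⟩, by simpa using fun _ _ => ht⟩

lemma isClosedCone_epiCone (b : Fin m) : IsClosedCone (epiCone X A b) where
  zero := vertical_mem_epiCone b le_rfl
  add := by
    rintro u ⟨⟨hu, hu'⟩, hux⟩ w ⟨⟨hw, hw'⟩, hwx⟩
    refine ⟨⟨fun i hi => add_nonneg (hu i hi) (hw i hi), ?_⟩, fun x hx => ?_⟩
    · simp [Finset.sum_add_distrib, hu', hw']
    · have := add_nonneg (hux x hx) (hwx x hx)
      simp only [Prod.fst_add, Prod.snd_add, Pi.add_apply, add_mul, Finset.sum_add_distrib]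
      linarith
  smul := by
    rintro t ht u ⟨⟨hu, hu'⟩, hux⟩
    refine ⟨⟨fun i hi => mul_nonneg ht (hu i hi), ?_⟩, fun x hx => ?_⟩
    · simp [← Finset.mul_sum, hu']
    · have := mul_nonneg ht (hux x hx)
      simpa only [Prod.smul_fst, Prod.smul_snd, Pi.smul_apply, smul_eq_mul, mul_assoc,
        ← Finset.mul_sum, ← mul_add] using this
  closed := by
    have h : epiCone X A b = (⋂ i, ⋂ (_ : i ≠ b), {p : (Fin m → ℝ) × ℝ | 0 ≤ p.1 i}) ∩
        {p | ∑ i, p.1 i = 0} ∩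
        ⋂ x ∈ X, {p | 0 ≤ ∑ i, p.1 i * dotp (A i) x + p.2} := by
      ext p
      simp [epiCone, Nbeta]
    rw [h]
    refine IsClosed.inter (IsClosed.inter ?_ ?_) ?_
    · exact isClosed_iInter fun i => isClosed_iInter fun _ =>
        isClosed_le continuous_const (by fun_prop)
    · exact isClosed_eq (by fun_prop) continuous_const
    · exact isClosed_biInter fun x _ => isClosed_le continuous_const (by fun_prop)

lemma isClosedCone_AgeCone (b : Fin m) : IsClosedCone (AgeCone X A b) where
  zero := by simp [AgeCone]
  add := by
    rintro u ⟨hu, hux⟩ w ⟨hw, hwx⟩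
    refine ⟨fun i hi => add_nonneg (hu i hi) (hw i hi), fun x hx => ?_⟩
    have := add_nonneg (hux x hx) (hwx x hx)
    simpa only [Pi.add_apply, add_mul, Finset.sum_add_distrib] using this
  smul := by
    rintro t ht u ⟨hu, hux⟩
    refine ⟨fun i hi => mul_nonneg ht (hu i hi), fun x hx => ?_⟩
    have := mul_nonneg ht (hux x hx)
    simpa only [Pi.smul_apply, smul_eq_mul, mul_assoc, ← Finset.mul_sum] using this
  closed := by
    have h : AgeCone X A b = (⋂ i, ⋂ (_ : i ≠ b), {c : Fin m → ℝ | 0 ≤ c i}) ∩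
        ⋂ x ∈ X, {c | 0 ≤ ∑ i, c i * Real.exp (dotp (A i) x)} := by
      ext p
      simp [AgeCone]
    rw [h]
    refine IsClosed.inter ?_ ?_
    · exact isClosed_iInter fun i => isClosed_iInter fun _ =>
        isClosed_le continuous_const (by fun_prop)
    · exact isClosed_biInter fun x _ => isClosed_le continuous_const (by fun_prop)

lemma nonneg_mem_AgeCone {c : Fin m → ℝ} (hc : ∀ i, 0 ≤ c i) (b : Fin m) :
    c ∈ AgeCone X A b :=
  ⟨fun i _ => hc i, fun _ _ => Finset.sum_nonneg fun i _ => mul_nonneg (hc i) (Real.exp_pos _).le⟩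

/-- Linear independence of the exponentials yields a functional that is strictly positive on all
AGE cones. -/
lemma exists_pos_on_AgeCone (hLI : ExpLinIndep X A) :
    ∃ w : Fin m → ℝ, ∀ b, ∀ c ∈ AgeCone X A b, c ≠ 0 → 0 < coeffPairing w c := by
  have hne : ∀ c : Fin m → ℝ, c ≠ 0 → ∃ x ∈ X, ∑ i, c i * Real.exp (dotp (A i) x) ≠ 0 := by
    intro c hc
    by_contra! h
    refine hc (funext fun i => Fintype.linearIndependent_iff.1 hLI c ?_ i)
    funext x
    simpa using h x x.2
  obtain ⟨t, ht⟩ := (isCompact_sphere (0 : Fin m → ℝ) 1).elim_finite_subcover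
    (fun x : X => {c : Fin m → ℝ | ∑ i, c i * Real.exp (dotp (A i) (x : Fin n → ℝ)) ≠ 0})
    (fun x => isOpen_ne_fun (by fun_prop) continuous_const)
    (by
      intro c hc
      obtain ⟨x, hx, h⟩ := hne c (by rintro rfl; simp at hc)
      exact Set.mem_iUnion.2 ⟨⟨x, hx⟩, h⟩)
  refine ⟨fun i => ∑ x ∈ t, Real.exp (dotp (A i) (x : Fin n → ℝ)), fun b c hc h0 => ?_⟩
  have hpair : coeffPairing (fun i => ∑ x ∈ t, Real.exp (dotp (A i) (x : Fin n → ℝ))) c =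
      ∑ x ∈ t, ∑ i, c i * Real.exp (dotp (A i) (x : Fin n → ℝ)) := by
    rw [coeffPairing_apply, Finset.sum_comm]
    simp only [Finset.mul_sum]
  have hn : 0 < ‖c‖ := norm_pos_iff.2 h0
  have hmem : ‖c‖⁻¹ • c ∈ Metric.sphere (0 : Fin m → ℝ) 1 := by
    simp [norm_smul, h0]
  obtain ⟨x, hxt, hx⟩ := Set.mem_iUnion₂.1 (ht hmem)
  rw [hpair]
  refine Finset.sum_pos' (fun x _ => hc.2 x x.2) ⟨x, hxt, lt_of_le_of_ne (hc.2 x x.2) ?_⟩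
  intro h
  apply hx
  simp only [Pi.smul_apply, smul_eq_mul, mul_assoc, ← Finset.mul_sum, ← h, mul_zero]

/-- Jensen's inequality for the exponential with one negative weight. -/
lemma sum_mul_exp_nonneg {b : Fin m} {ν : Fin m → ℝ} (hν : ν ∈ Nbeta b) {z : Fin m → ℝ}
    (hz : 0 ≤ ∑ i, ν i * z i) : 0 ≤ ∑ i, ν i * Real.exp (z i) := by
  have hle : ∀ i ∈ Finset.univ,
      ν i * (Real.exp (z b) * (1 + z i - z b)) ≤ ν i * Real.exp (z i) := by
    intro i _
    by_cases hi : i = b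
    · subst hi; simp
    · refine mul_le_mul_of_nonneg_left ?_ (hν.1 i hi)
      have h1 := Real.add_one_le_exp (z i - z b)
      have h2 : Real.exp (z i) = Real.exp (z b) * Real.exp (z i - z b) := by
        rw [← Real.exp_add]; congr 1; ring
      rw [h2]
      exact mul_le_mul_of_nonneg_left (by linarith) (Real.exp_pos _).le
  refine le_trans ?_ (Finset.sum_le_sum hle)
  have : ∑ i, ν i * (Real.exp (z b) * (1 + z i - z b)) =
      Real.exp (z b) * ((1 - z b) * ∑ i, ν i + ∑ i, ν i * z i) := by
    rw [Finset.mul_sum, ← Finset.sum_add_distrib, Finset.mul_sum]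
    exact Finset.sum_congr rfl fun i _ => by ring
  rw [this, hν.2, mul_zero, zero_add]
  exact mul_nonneg (Real.exp_pos _).le hz

lemma Nbeta_neg {b : Fin m} {ν : Fin m → ℝ} (hν : ν ∈ Nbeta b) (h0 : ν ≠ 0) : ν b < 0 := by
  by_contra! h
  have hnn : ∀ i, 0 ≤ ν i := fun i => by
    by_cases hi : i = b
    · exact hi ▸ h
    · exact hν.1 i hi
  exact h0 (funext fun i =>
    (Finset.sum_eq_zero_iff_of_nonneg fun i _ => hnn i).1 hν.2 i (Finset.mem_univ i))

lemma pos_of_pos_on_AgeCone {w : Fin m → ℝ}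
    (hw : ∀ b, ∀ c ∈ AgeCone X A b, c ≠ 0 → 0 < coeffPairing w c) (i : Fin m) : 0 < w i := by
  have hmem : Pi.single i (1 : ℝ) ∈ AgeCone X A i :=
    nonneg_mem_AgeCone (single_one_nonneg i) i
  simpa [Pi.single_apply] using hw i _ hmem (by simp)

/-- A functional that is positive on the AGE cones is, after taking logarithms, positive on the
epigraphs. -/
lemma graphPairing_log_pos (hX : X.Nonempty) {w : Fin m → ℝ}
    (hw : ∀ b, ∀ c ∈ AgeCone X A b, c ≠ 0 → 0 < coeffPairing w c) (b : Fin m) :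
    ∀ p ∈ epiCone X A b, p ≠ 0 → 0 < graphPairing (fun i => Real.log (w i)) p := by
  rintro ⟨ν, t⟩ ⟨hν, hp⟩ h0
  simp only at hν hp
  have hwp := pos_of_pos_on_AgeCone hw
  by_cases hν0 : ν = 0
  · obtain ⟨x, hx⟩ := hX
    have ht := hp x hx
    have ht0 : t ≠ 0 := by
      rintro rfl
      exact h0 (by simp [hν0])
    simp only [hν0, Pi.zero_apply, zero_mul, Finset.sum_const_zero, zero_add] at ht
    simpa [hν0] using lt_of_le_of_ne ht ht0.symm
  · by_contra! hneg
    simp only [graphPairing_apply] at hneg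
    have hmem : (fun i => ν i / w i) ∈ AgeCone X A b := by
      refine ⟨fun i hi => div_nonneg (hν.1 i hi) (hwp i).le, fun x hx => ?_⟩
      have hz : 0 ≤ ∑ i, ν i * (dotp (A i) x - Real.log (w i)) := by
        have := hp x hx
        simp only [mul_sub, Finset.sum_sub_distrib]
        linarith
      refine (sum_mul_exp_nonneg hν hz).trans (le_of_eq ?_)
      refine Finset.sum_congr rfl fun i _ => ?_
      rw [Real.exp_sub, Real.exp_log (hwp i)]
      ring
    have h1 := hw b _ hmem (by
      intro h
      refine hν0 (funext fun i => ?_)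
      have := congrFun h i
      simpa [(hwp i).ne'] using this)
    rw [coeffPairing_apply] at h1
    have h2 : ∑ i, ν i / w i * w i = 0 := by
      rw [← hν.2]
      exact Finset.sum_congr rfl fun i _ => div_mul_cancel₀ _ (hwp i).ne'
    exact h1.ne' h2

lemma circuitGraph_subset (hX : X.Nonempty) (b₀ : Fin m)
    (hS : IsClosedCone (coneSum (epiCone X A))) :
    circuitGraph X A ⊆ coneSum (epiCone X A) := by
  rintro p ⟨k, t, v, ht, hv, rfl⟩
  refine hS.sum_mem _ _ fun j _ => hS.smul _ (ht j) _ ?_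
  rcases hv j with ⟨l, hl, hlv⟩ | hj
  · obtain ⟨b, hb⟩ := Set.mem_iUnion.1 hl
    rw [← hlv]
    exact subset_coneSum isClosedCone_epiCone b (phiVec_mem_epiCone hX hb.1.1 hb.1.2.2.1)
  · rw [Set.mem_singleton_iff.1 hj]
    exact subset_coneSum isClosedCone_epiCone b₀ (vertical_mem_epiCone b₀ zero_le_one)

lemma subset_coneHull {E : Type*} [AddCommMonoid E] [Module ℝ E] (S : Set E) :
    S ⊆ coneHull S := fun v hv =>
  ⟨1, fun _ => 1, fun _ => v, fun _ => zero_le_one, fun _ => hv, by simp⟩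

/-- An affine combination of extended reals with a finite value has finite terms. -/
lemma lt_top_of_convex_comb {x y : EReal} {θ : ℝ} (hθ : θ ∈ Set.Ioo (0 : ℝ) 1) (hx : x ≠ ⊥)
    (hy : y ≠ ⊥) (h : (θ : EReal) * x + ((1 - θ : ℝ) : EReal) * y < ⊤) : x < ⊤ ∧ y < ⊤ := by
  have hθ' : 0 < 1 - θ := sub_pos.2 hθ.2
  induction x with
  | bot => exact absurd rfl hx
  | top =>
    exfalso
    rw [EReal.coe_mul_top_of_pos hθ.1, EReal.top_add_of_ne_bot] at h
    · exact lt_irrefl _ h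
    · induction y with
      | bot => exact absurd rfl hy
      | top => rw [EReal.coe_mul_top_of_pos hθ']; simp
      | coe y => rw [← EReal.coe_mul]; exact EReal.coe_ne_bot _
  | coe x =>
    refine ⟨EReal.coe_lt_top x, ?_⟩
    induction y with
    | bot => exact absurd rfl hy
    | top =>
      exfalso
      rw [EReal.coe_mul_top_of_pos hθ', ← EReal.coe_mul,
        EReal.add_top_of_ne_bot (EReal.coe_ne_bot _)] at h
      exact lt_irrefl _ h
    | coe y => exact EReal.coe_lt_top y

/-- A normalized vector whose functional form spans an extreme ray of the sum of the epigraphs is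
an `X`-circuit. -/
lemma isXCircuit_of_isEdgeGenerator (hX : X.Nonempty) {b : Fin m} {l : Fin m → ℝ}
    (hl : l ∈ Nbeta b) (hl0 : l ≠ 0) (hfin : sigA X A l < ⊤)
    (hedge : IsEdgeGenerator (coneSum (epiCone X A)) (phiVec X A l)) : IsXCircuit X A b l := by
  refine ⟨hl, hl0, hfin, ?_⟩
  rintro ⟨ν₁, ν₂, θ, h₁, h₂, hprop, hθ, hcomb, haff⟩
  have hθ' : 0 < 1 - θ := sub_pos.2 hθ.2
  have hval := haff θ ⟨hθ.1.le, hθ.2.le⟩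
  rw [← hcomb] at hval
  obtain ⟨hf₁, hf₂⟩ := lt_top_of_convex_comb hθ (sigA_ne_bot hX ν₁) (sigA_ne_bot hX ν₂)
    (hval ▸ hfin)
  have hreal : (sigA X A l).toReal =
      θ * (sigA X A ν₁).toReal + (1 - θ) * (sigA X A ν₂).toReal := by
    rw [← coe_toReal_sigA hX hf₁, ← coe_toReal_sigA hX hf₂, ← coe_toReal_sigA hX hfin] at hval
    exact_mod_cast hval
  have hK := isClosedCone_epiCone (X := X) (A := A) b
  have hsplit : phiVec X A l = θ • phiVec X A ν₁ + (1 - θ) • phiVec X A ν₂ := by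
    ext1
    · exact hcomb
    · exact hreal
  obtain ⟨⟨a₁, -, hv₁⟩, ⟨a₂, -, hv₂⟩⟩ := hedge.2.2 _
    (subset_coneSum isClosedCone_epiCone b (hK.smul _ hθ.1.le _ (phiVec_mem_epiCone hX h₁ hf₁))) _
    (subset_coneSum isClosedCone_epiCone b (hK.smul _ hθ'.le _ (phiVec_mem_epiCone hX h₂ hf₂)))
    hsplit
  have e₁ : θ • ν₁ = a₁ • l := congrArg Prod.fst hv₁
  have e₂ : (1 - θ) • ν₂ = a₂ • l := congrArg Prod.fst hv₂
  have e₁' : ν₁ = (θ⁻¹ * a₁) • l := by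
    rw [mul_smul, ← e₁, inv_smul_smul₀ hθ.1.ne']
  have e₂' : ν₂ = ((1 - θ)⁻¹ * a₂) • l := by
    rw [mul_smul, ← e₂, inv_smul_smul₀ hθ'.ne']
  apply hprop
  by_cases ha : θ⁻¹ * a₁ = 0
  · exact ⟨0, Or.inl (by rw [e₁', ha, zero_smul, zero_smul])⟩
  · refine ⟨(1 - θ)⁻¹ * a₂ * (θ⁻¹ * a₁)⁻¹, Or.inr ?_⟩
    rw [mul_smul, e₁', inv_smul_smul₀ ha, e₂']

/-- If an affine functional is negative somewhere on an epigraph, it is negative on the functional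
form of some reduced circuit. -/
lemma exists_LambdaStar_neg (hX : X.Nonempty) (hLI : ExpLinIndep X A) {b₀ : Fin m}
    {y : Fin m → ℝ} {q : (Fin m → ℝ) × ℝ} (hq : q ∈ epiCone X A b₀)
    (hneg : graphPairing y q < 0) :
    ∃ l ∈ LambdaStar X A, graphPairing y (phiVec X A l) < 0 := by
  obtain ⟨w, hw⟩ := exists_pos_on_AgeCone hLI
  have hK : ∀ b, IsClosedCone (epiCone X A b) := isClosedCone_epiCone
  have hpos := graphPairing_log_pos hX hw
  have hS := isClosedCone_coneSum hK _ hpos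
  obtain ⟨p, hp, hpy⟩ := hS.exists_isEdgeGenerator _ (graphPairing y) (coneSum_pos _ hpos)
    (subset_coneSum hK b₀ hq) hneg
  obtain ⟨b, hpb⟩ := hp.mem_summand hK
  have hν0 : p.1 ≠ 0 := by
    intro h
    obtain ⟨x, hx⟩ := hX
    have := hpb.2 x hx
    simp only [h, graphPairing_apply, Pi.zero_apply, zero_mul, Finset.sum_const_zero,
      zero_add] at this hpy
    linarith
  have hνb := Nbeta_neg hpb.1 hν0
  have hs : 0 < (-p.1 b)⁻¹ := inv_pos.2 (neg_pos.2 hνb)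
  have hedge := hp.smul hS hs
  have hmem := (hK b).smul _ hs.le p hpb
  have hneg' : graphPairing y ((-p.1 b)⁻¹ • p) < 0 := by
    rw [map_smul, smul_eq_mul]
    exact mul_neg_of_pos_of_neg hs hpy
  have hnorm : ((-p.1 b)⁻¹ • p).1 b = -1 := by
    simp only [Prod.smul_fst, Pi.smul_apply, smul_eq_mul]
    field_simp [hνb.ne]
  generalize (-p.1 b)⁻¹ • p = p' at hedge hmem hneg' hnorm
  obtain ⟨l, t⟩ := p'
  simp only at hnorm
  have hl0 : l ≠ 0 := by
    rintro rfl
    simp at hnorm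
  have hle : sigA X A l ≤ (t : EReal) := sigA_le_iff.2 hmem.2
  have hfin : sigA X A l < ⊤ := hle.trans_lt (EReal.coe_lt_top t)
  have hle' : (sigA X A l).toReal ≤ t := by
    rw [← coe_toReal_sigA hX hfin] at hle
    exact_mod_cast hle
  have hl : l ∈ Nbeta b := hmem.1
  have hφ := phiVec_mem_epiCone hX hl hfin
  obtain ⟨-, ⟨a, -, ha⟩⟩ := hedge.2.2 _ (subset_coneSum hK b hφ) _
    (subset_coneSum hK b (vertical_mem_epiCone b (sub_nonneg.2 hle')))
    (by ext1 <;> simp [phiVec])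
  have ha0 : a = 0 := by
    have := congrFun (congrArg Prod.fst ha) b
    simpa [hnorm] using this
  have ht : t = (sigA X A l).toReal := by
    have := congrArg Prod.snd ha
    simp [ha0] at this
    linarith
  have hpeq : (l, t) = phiVec X A l := by simp [phiVec, ht]
  rw [hpeq] at hedge hneg'
  have hΛ : l ∈ Lambda X A :=
    Set.mem_iUnion.2 ⟨b, isXCircuit_of_isEdgeGenerator hX hl hl0 hfin hedge, hnorm⟩
  exact ⟨l, ⟨hΛ, hedge.mono (circuitGraph_subset hX b hS)
    (subset_coneHull _ (Or.inl ⟨l, hΛ, rfl⟩))⟩, hneg'⟩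


lemma pos_mem_filter_iff {b : Fin m} {l : Fin m → ℝ} (hl : l ∈ Nbeta b) (hb : l b = -1) (i : Fin m) :
    (i ∈ Finset.univ.filter fun i => 0 < l i) ↔ i ≠ b ∧ l i ≠ 0 := by
  simp only [Finset.mem_filter, Finset.mem_univ, true_and]
  refine ⟨fun h => ⟨?_, h.ne'⟩, fun h => lt_of_le_of_ne (hl.1 i h.1) h.2.symm⟩
  rintro rfl
  linarith

/-- Splitting a weighted sum into its negative and positive parts. -/
lemma sum_mul_eq_sub {b : Fin m} {l : Fin m → ℝ} (hl : l ∈ Nbeta b) (hb : l b = -1)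
    (z : Fin m → ℝ) :
    ∑ i, l i * z i = ∑ i ∈ Finset.univ.filter (fun i => 0 < l i), l i * z i - z b := by
  rw [← Finset.add_sum_erase _ _ (Finset.mem_univ b), hb]
  have : ∑ i ∈ Finset.univ.erase b, l i * z i =
      ∑ i ∈ Finset.univ.filter (fun i => 0 < l i), l i * z i := by
    symm
    refine Finset.sum_subset (fun i hi => ?_) fun i hi hi' => ?_
    · exact Finset.mem_erase.2 ⟨((pos_mem_filter_iff hl hb i).1 hi).1, Finset.mem_univ i⟩
    · rw [pos_mem_filter_iff hl hb] at hi'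
      have hib := Finset.ne_of_mem_erase hi
      have : l i = 0 := by
        by_contra h
        exact hi' ⟨hib, h⟩
      rw [this, zero_mul]
  rw [this]
  ring

lemma sum_pos_part {b : Fin m} {l : Fin m → ℝ} (hl : l ∈ Nbeta b) (hb : l b = -1) :
    ∑ i ∈ Finset.univ.filter (fun i => 0 < l i), l i = 1 := by
  have h := sum_mul_eq_sub hl hb (fun _ => 1)
  simp only [mul_one, hl.2] at h
  linarith

lemma WitnessCone_smul {b : Fin m} {l c : Fin m → ℝ} (hl : l ∈ Nbeta b) (hb : l b = -1)
    (hc : c ∈ WitnessCone X A b l) {t : ℝ} (ht : 0 < t) : t • c ∈ WitnessCone X A b l := by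
  refine ⟨fun i hi => mul_nonneg ht.le (hc.1 i hi), ?_⟩
  have hprod : ∏ i ∈ Finset.univ.filter (fun i => 0 < l i), ((t • c) i / l i) ^ (l i) =
      t * ∏ i ∈ Finset.univ.filter (fun i => 0 < l i), (c i / l i) ^ (l i) := by
    have h1 : ∏ i ∈ Finset.univ.filter (fun i => 0 < l i), t ^ (l i) = t := by
      rw [← Real.rpow_sum_of_pos ht, sum_pos_part hl hb, Real.rpow_one]
    nth_rewrite 2 [← h1]
    rw [← Finset.prod_mul_distrib]
    refine Finset.prod_congr rfl fun i hi => ?_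
    have hi' := (pos_mem_filter_iff hl hb i).1 hi
    rw [Pi.smul_apply, smul_eq_mul, mul_div_assoc,
      Real.mul_rpow ht.le (div_nonneg (hc.1 i hi'.1) (hl.1 i hi'.1))]
  rw [hprod]
  have := mul_le_mul_of_nonneg_left hc.2 ht.le
  simp only [Pi.smul_apply, smul_eq_mul]
  linarith

lemma nonneg_mem_WitnessCone (b : Fin m) {l c : Fin m → ℝ} (hc : ∀ i, 0 ≤ c i) :
    c ∈ WitnessCone X A b l := by
  refine ⟨fun i _ => hc i, le_trans (b := 0) ?_ (Finset.prod_nonneg fun i hi => ?_)⟩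
  · exact mul_nonpos_of_nonpos_of_nonneg (neg_nonpos.2 (hc b)) (Real.exp_pos _).le
  · exact Real.rpow_nonneg (div_nonneg (hc i) (Finset.mem_filter.1 hi).2.le) _

/-- Witnessed AGE cones consist of AGE functions. -/
lemma WitnessCone_subset_AgeCone (hX : X.Nonempty) {b : Fin m} {l : Fin m → ℝ}
    (hl : l ∈ Nbeta b) (hb : l b = -1) (hfin : sigA X A l < ⊤) :
    WitnessCone X A b l ⊆ AgeCone X A b := by
  rintro c ⟨hc, hprod⟩
  by_cases hcb : 0 ≤ c b
  · refine nonneg_mem_AgeCone (fun i => ?_) b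
    by_cases hi : i = b
    · exact hi ▸ hcb
    · exact hc i hi
  push Not at hcb
  have hlhs : 0 < -(c b) * Real.exp (sigA X A l).toReal :=
    mul_pos (neg_pos.2 hcb) (Real.exp_pos _)
  have hcpos : ∀ i ∈ Finset.univ.filter (fun i => 0 < l i), 0 < c i / l i := by
    intro i hi
    have hi' := (pos_mem_filter_iff hl hb i).1 hi
    have hli := (Finset.mem_filter.1 hi).2
    refine div_pos (lt_of_le_of_ne (hc i hi'.1) fun h0 => ?_) hli
    have : ∏ i ∈ Finset.univ.filter (fun i => 0 < l i), (c i / l i) ^ (l i) = 0 :=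
      Finset.prod_eq_zero hi (by rw [← h0, zero_div, Real.zero_rpow hli.ne'])
    linarith
  refine ⟨hc, fun x hx => ?_⟩
  set r : Fin m → ℝ := fun i => if i = b then -(c b) else c i / l i with hr
  have hlog : 0 ≤ ∑ i, l i * Real.log (r i) - (sigA X A l).toReal := by
    rw [sum_mul_eq_sub hl hb]
    have h1 := Real.log_le_log hlhs hprod
    rw [Real.log_mul (neg_pos.2 hcb).ne' (Real.exp_pos _).ne', Real.log_exp,
      Real.log_prod fun i hi => (Real.rpow_pos_of_pos (hcpos i hi) _).ne'] at h1
    have h2 : ∑ i ∈ Finset.univ.filter (fun i => 0 < l i), Real.log ((c i / l i) ^ l i) =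
        ∑ i ∈ Finset.univ.filter (fun i => 0 < l i), l i * Real.log (r i) := by
      refine Finset.sum_congr rfl fun i hi => ?_
      have hi' := (pos_mem_filter_iff hl hb i).1 hi
      rw [Real.log_rpow (hcpos i hi)]
      simp [hr, hi'.1]
    have h3 : r b = -(c b) := by simp [hr]
    rw [h3]
    linarith
  have hsig := (phiVec_mem_epiCone hX hl hfin).2 x hx
  simp only [phiVec] at hsig
  have hz : 0 ≤ ∑ i, l i * (Real.log (r i) + dotp (A i) x) := by
    simp only [mul_add, Finset.sum_add_distrib]
    linarith
  refine (sum_mul_exp_nonneg hl hz).trans (Finset.sum_le_sum fun i _ => ?_)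
  rw [Real.exp_add, ← mul_assoc]
  refine mul_le_mul_of_nonneg_right ?_ (Real.exp_pos _).le
  by_cases hi : i = b
  · subst hi
    simp only [hr, if_true]
    rw [Real.exp_log (neg_pos.2 hcb), hb]
    linarith
  · by_cases hli : l i = 0
    · simpa [hli] using hc i hi
    · have := hcpos i ((pos_mem_filter_iff hl hb i).2 ⟨hi, hli⟩)
      simp only [hr, if_neg hi]
      rw [Real.exp_log this, mul_div_cancel₀ _ hli]

/-- A positive functional that is nonnegative on a witnessed AGE cone has nonnegative pairing of
its logarithm with the corresponding functional form. -/
lemma graphPairing_nonneg_of_WitnessCone {b : Fin m} {l : Fin m → ℝ} (hl : l ∈ Nbeta b)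
    (hb : l b = -1) {v : Fin m → ℝ} (hv : ∀ i, 0 < v i)
    (hdual : ∀ c ∈ WitnessCone X A b l, 0 ≤ coeffPairing v c) :
    0 ≤ graphPairing (fun i => Real.log (v i)) (phiVec X A l) := by
  set k : ℝ := graphPairing (fun i => Real.log (v i)) (phiVec X A l) with hk
  have hk' : k = ∑ i, l i * Real.log (v i) + (sigA X A l).toReal := by
    rw [hk, graphPairing_apply]; rfl
  set c : Fin m → ℝ := fun i => if i = b then -(Real.exp (-k) / v b) else l i / v i with hc
  have hcb : c b = -(Real.exp (-k) / v b) := by simp [hc]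
  have hcne : ∀ i, i ≠ b → c i = l i / v i := fun i hi => by simp [hc, hi]
  have hmem : c ∈ WitnessCone X A b l := by
    refine ⟨fun i hi => ?_, le_of_eq ?_⟩
    · rw [hcne i hi]
      exact div_nonneg (hl.1 i hi) (hv i).le
    · have hprod : ∏ i ∈ Finset.univ.filter (fun i => 0 < l i), (c i / l i) ^ (l i) =
          Real.exp (-∑ i ∈ Finset.univ.filter (fun i => 0 < l i), l i * Real.log (v i)) := by
        rw [← Finset.sum_neg_distrib, Real.exp_sum]
        refine Finset.prod_congr rfl fun i hi => ?_
        have hi' := (pos_mem_filter_iff hl hb i).1 hi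
        have h1 : c i / l i = (v i)⁻¹ := by
          rw [hcne i hi'.1, div_div_cancel_left' hi'.2]
        rw [h1, Real.rpow_def_of_pos (inv_pos.2 (hv i)), Real.log_inv]
        congr 1
        ring
      rw [hprod, hcb, neg_neg]
      have h2 : Real.exp (-k) / v b = Real.exp (-k - Real.log (v b)) := by
        rw [Real.exp_sub, Real.exp_log (hv b)]
      rw [h2, ← Real.exp_add, hk', sum_mul_eq_sub hl hb]
      congr 1
      ring
  have h := hdual c hmem
  have hsum : coeffPairing v c = 1 - Real.exp (-k) := by
    have hrest : ∑ i ∈ Finset.univ.erase b, c i * v i = ∑ i ∈ Finset.univ.erase b, l i := by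
      refine Finset.sum_congr rfl fun i hi => ?_
      rw [hcne i (Finset.ne_of_mem_erase hi), div_mul_cancel₀ _ (hv i).ne']
    have htot := Finset.add_sum_erase _ l (Finset.mem_univ b)
    rw [hl.2, hb] at htot
    rw [coeffPairing_apply, ← Finset.add_sum_erase _ _ (Finset.mem_univ b), hrest, hcb, neg_mul,
      div_mul_cancel₀ _ (hv b).ne']
    linarith
  rw [hsum] at h
  have h1 : Real.exp (-k) ≤ 1 := by linarith
  rw [Real.exp_le_one_iff] at h1
  linarith

/-- A vector whose pairing with the epigraph over `N_β` is nonnegative exponentiates to an element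
of the dual AGE cone. -/
lemma coeffPairing_exp_nonneg (hX : X.Nonempty) (hXcv : Convex ℝ X) {b : Fin m} {y : Fin m → ℝ}
    (hy : ∀ p ∈ epiCone X A b, 0 ≤ graphPairing y p) {c : Fin m → ℝ}
    (hc : c ∈ AgeCone X A b) : 0 ≤ ∑ i, c i * Real.exp (y i) := by
  set T : Set (Fin m → ℝ) :=
    {z | ∃ x ∈ X, ∀ i, dotp (A i) x - dotp (A b) x ≤ z i - z b} with hT
  have hdot : ∀ (a u v : Fin n → ℝ) (s t : ℝ),
      dotp a (s • u + t • v) = s * dotp a u + t * dotp a v := by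
    intro a u v s t
    simp only [dotp, Pi.add_apply, Pi.smul_apply, smul_eq_mul, Finset.mul_sum,
      ← Finset.sum_add_distrib]
    exact Finset.sum_congr rfl fun i _ => by ring
  have hTconv : Convex ℝ T := by
    rintro z ⟨x, hx, hz⟩ z' ⟨x', hx', hz'⟩ s t hs ht hst
    refine ⟨s • x + t • x', hXcv hx hx' hs ht hst, fun i => ?_⟩
    have h1 := mul_le_mul_of_nonneg_left (hz i) hs
    have h2 := mul_le_mul_of_nonneg_left (hz' i) ht
    simp only [hdot, Pi.add_apply, Pi.smul_apply, smul_eq_mul]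
    linarith
  have hyT : y ∈ closure T := by
    by_contra hyT
    obtain ⟨f, u, hfy, hfT⟩ :=
      geometric_hahn_banach_point_closed hTconv.closure isClosed_closure hyT
    have hfT' : ∀ z ∈ T, u < f z := fun z hz => hfT z (subset_closure hz)
    set ν : Fin m → ℝ := fun i => f (Pi.single i 1) with hν
    have hf : ∀ z, f z = ∑ i, ν i * z i := by
      intro z
      conv_lhs => rw [eq_coeffPairing f, coeffPairing_apply]
      exact Finset.sum_congr rfl fun i _ => mul_comm _ _
    have hbase : ∀ x ∈ X, (fun i => dotp (A i) x) ∈ T := fun x hx => ⟨x, hx, fun i => le_rfl⟩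
    have hray : ∀ d : Fin m → ℝ, (∀ i, 0 ≤ d i - d b) → 0 ≤ f d := by
      intro d hd
      obtain ⟨x, hx⟩ := hX
      by_contra! hneg
      obtain ⟨N, hN⟩ := exists_nat_gt ((f (fun i => dotp (A i) x) - u) / -f d)
      have hmem : (fun i => dotp (A i) x) + (N : ℝ) • d ∈ T := by
        refine ⟨x, hx, fun i => ?_⟩
        have := mul_nonneg (Nat.cast_nonneg (α := ℝ) N) (hd i)
        simp only [Pi.add_apply, Pi.smul_apply, smul_eq_mul]
        linarith
      have h1 := hfT' _ hmem
      rw [map_add, map_smul, smul_eq_mul] at h1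
      rw [div_lt_iff₀ (neg_pos.2 hneg)] at hN
      linarith
    have hνmem : ν ∈ Nbeta b := by
      refine ⟨fun i hi => hray _ fun j => ?_, ?_⟩
      · have : (Pi.single i (1 : ℝ) : Fin m → ℝ) b = 0 := by simp [hi.symm]
        rw [this, sub_zero]
        exact single_one_nonneg i j
      · have h1 := hray (fun _ => 1) (by simp)
        have h2 := hray (fun _ => -1) (by simp)
        rw [hf] at h1 h2
        simp only [mul_one, mul_neg, Finset.sum_neg_distrib] at h1 h2
        linarith
    have hepi : (ν, -u) ∈ epiCone X A b := by
      refine ⟨hνmem, fun x hx => ?_⟩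
      have := hfT' _ (hbase x hx)
      rw [hf] at this
      simp only
      linarith
    have := hy _ hepi
    rw [graphPairing_apply, ← hf] at this
    linarith
  have hclosed : IsClosed {z : Fin m → ℝ | 0 ≤ ∑ i, c i * Real.exp (z i)} :=
    isClosed_le continuous_const (by fun_prop)
  refine closure_minimal ?_ hclosed hyT
  rintro z ⟨x, hx, hz⟩
  have h1 : 0 ≤ Real.exp (z b - dotp (A b) x) * ∑ i, c i * Real.exp (dotp (A i) x) :=
    mul_nonneg (Real.exp_pos _).le (hc.2 x hx)
  refine h1.trans ?_
  rw [Finset.mul_sum]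
  refine Finset.sum_le_sum fun i _ => ?_
  have h2 : Real.exp (z b - dotp (A b) x) * (c i * Real.exp (dotp (A i) x)) =
      c i * Real.exp (z b + (dotp (A i) x - dotp (A b) x)) := by
    rw [mul_left_comm, ← Real.exp_add]
    congr 2
    ring
  rw [h2]
  by_cases hi : i = b
  · subst hi
    simp
  · refine mul_le_mul_of_nonneg_left (Real.exp_le_exp.2 ?_) (hc.1 i hi)
    have := hz i
    linarith

lemma coeffPairing_nonneg_of_nonneg_WitnessCone (hX : X.Nonempty) (hXcv : Convex ℝ X)
    (hLI : ExpLinIndep X A) {v : Fin m → ℝ} (hv : ∀ i, 0 ≤ v i)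
    (hdual : ∀ l ∈ LambdaStar X A, ∀ b, l b = -1 → ∀ c ∈ WitnessCone X A b l,
      0 ≤ coeffPairing v c) {c : Fin m → ℝ} (hc : c ∈ Sage X A) : 0 ≤ coeffPairing v c := by
  obtain ⟨w, hw⟩ := exists_pos_on_AgeCone hLI
  have hwp := pos_of_pos_on_AgeCone hw
  have hadd : ∀ (ε : ℝ) (c : Fin m → ℝ),
      coeffPairing (v + ε • w) c = coeffPairing v c + ε * coeffPairing w c := by
    intro ε c
    simp only [coeffPairing_apply, Pi.add_apply, Pi.smul_apply, smul_eq_mul, mul_add,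
      Finset.sum_add_distrib, Finset.mul_sum, mul_left_comm]
  have hage : ∀ b, ∀ c ∈ AgeCone X A b, ∀ ε : ℝ, 0 < ε → 0 ≤ coeffPairing (v + ε • w) c := by
    intro b c hc ε hε
    have hpos : ∀ i, 0 < (v + ε • w) i := fun i =>
      add_pos_of_nonneg_of_pos (hv i) (mul_pos hε (hwp i))
    have hepi : ∀ p ∈ epiCone X A b,
        0 ≤ graphPairing (fun i => Real.log ((v + ε • w) i)) p := by
      intro p hp
      by_contra! hneg
      obtain ⟨l, hl, hlneg⟩ := exists_LambdaStar_neg hX hLI hp hneg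
      obtain ⟨b', hb'⟩ := Set.mem_iUnion.1 hl.1
      refine hlneg.not_ge (graphPairing_nonneg_of_WitnessCone hb'.1.1 hb'.2 hpos fun c hc => ?_)
      rw [hadd]
      refine add_nonneg (hdual l hl b' hb'.2 c hc) (mul_nonneg hε.le ?_)
      exact IsClosedCone.nonneg_of_pos (hw b')
        (WitnessCone_subset_AgeCone hX hb'.1.1 hb'.2 hb'.1.2.2.1 hc)
    have := coeffPairing_exp_nonneg hX hXcv hepi hc
    rw [coeffPairing_apply]
    simpa only [Real.exp_log (hpos _)] using this
  have hage' : ∀ b, ∀ c ∈ AgeCone X A b, 0 ≤ coeffPairing v c := by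
    intro b c hc
    have hW : 0 ≤ coeffPairing w c := IsClosedCone.nonneg_of_pos (hw b) hc
    by_contra! hneg
    have h := hage b c hc (-coeffPairing v c / (2 * (coeffPairing w c + 1)))
      (div_pos (neg_pos.2 hneg) (by positivity))
    rw [hadd, div_mul_eq_mul_div, ← sub_neg_eq_add, sub_nonneg, neg_le_iff_add_nonneg] at h
    have h2 : -coeffPairing v c * coeffPairing w c / (2 * (coeffPairing w c + 1)) <
        -coeffPairing v c := by
      rw [div_lt_iff₀ (by positivity)]
      nlinarith
    linarith
  obtain ⟨f, hf, rfl⟩ := hc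
  rw [map_sum]
  exact Finset.sum_nonneg fun b _ => hage' b _ (hf b)

lemma isClosedCone_Sage (hLI : ExpLinIndep X A) : IsClosedCone (Sage X A) := by
  obtain ⟨w, hw⟩ := exists_pos_on_AgeCone hLI
  exact isClosedCone_coneSum isClosedCone_AgeCone (coeffPairing w) hw

lemma AgeCone_subset_Sage (b : Fin m) : AgeCone X A b ⊆ Sage X A :=
  subset_coneSum isClosedCone_AgeCone b

lemma LambdaStar_nonempty (hX : X.Nonempty) (hLI : ExpLinIndep X A)
    (hΛ : (Lambda X A).Nonempty) : (LambdaStar X A).Nonempty := by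
  obtain ⟨l, hl⟩ := hΛ
  obtain ⟨b, hb⟩ := Set.mem_iUnion.1 hl
  have hneg : graphPairing (Pi.single b ((sigA X A l).toReal + 1)) (phiVec X A l) < 0 := by
    simp [phiVec, Pi.single_apply, hb.2]
  obtain ⟨l', hl', -⟩ := exists_LambdaStar_neg hX hLI
    (phiVec_mem_epiCone hX hb.1.1 hb.1.2.2.1) hneg
  exact ⟨l', hl'⟩

lemma mem_iUnion_WitnessConeL {c l : Fin m → ℝ} {b : Fin m} (hl : l ∈ LambdaStar X A)
    (hb : l b = -1) (hc : c ∈ WitnessCone X A b l) :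
    c ∈ ⋃ l ∈ LambdaStar X A, WitnessConeL X A l :=
  Set.mem_iUnion₂.2 ⟨l, hl, Set.mem_iUnion₂.2 ⟨b, hb, hc⟩⟩

lemma iUnion_WitnessConeL_subset_Sage (hX : X.Nonempty) :
    ⋃ l ∈ LambdaStar X A, WitnessConeL X A l ⊆ Sage X A := by
  intro c hc
  obtain ⟨l, hl, hc⟩ := Set.mem_iUnion₂.1 hc
  obtain ⟨b, hb, hc⟩ := Set.mem_iUnion₂.1 hc
  obtain ⟨b', hb'⟩ := Set.mem_iUnion.1 hl.1
  have hbb : b = b' := by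
    by_contra h
    have h1 := hb'.1.1.1 b h
    have h2 : l b = -1 := hb
    linarith
  subst hbb
  exact AgeCone_subset_Sage b (WitnessCone_subset_AgeCone hX hb'.1.1 hb'.2 hb'.1.2.2.1 hc)

lemma Sage_eq_nonneg_of_Lambda_eq_empty (hX : X.Nonempty) (hXcv : Convex ℝ X)
    (hm : 0 < m) (hLI : ExpLinIndep X A) (hΛ : Lambda X A = ∅) :
    Sage X A = {c : Fin m → ℝ | ∀ i, 0 ≤ c i} := by
  refine Set.Subset.antisymm (fun c hc i => ?_)
    fun c hc => AgeCone_subset_Sage ⟨0, hm⟩ (nonneg_mem_AgeCone hc _)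
  have h := coeffPairing_nonneg_of_nonneg_WitnessCone hX hXcv hLI (v := Pi.single i 1)
    (single_one_nonneg i)
    (fun l hl => absurd hl.1 (by simp [hΛ])) hc
  simpa [Pi.single_apply] using h

lemma Sage_subset_closure (hX : X.Nonempty) (hXcv : Convex ℝ X) (hLI : ExpLinIndep X A)
    (hΛ : (Lambda X A).Nonempty) :
    Sage X A ⊆ closure (convexHull ℝ (⋃ l ∈ LambdaStar X A, WitnessConeL X A l)) := by
  intro c hc
  by_contra hcR
  obtain ⟨f, u, hfc, hfR⟩ := geometric_hahn_banach_point_closed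
    (convex_convexHull ℝ (⋃ l ∈ LambdaStar X A, WitnessConeL X A l)).closure isClosed_closure hcR
  have hu : ∀ l ∈ LambdaStar X A, ∀ b, l b = -1 → ∀ c ∈ WitnessCone X A b l, u < f c :=
    fun l hl b hb c hc =>
      hfR c (subset_closure (subset_convexHull ℝ _ (mem_iUnion_WitnessConeL hl hb hc)))
  have hnn : ∀ l ∈ LambdaStar X A, ∀ b, l b = -1 → ∀ c ∈ WitnessCone X A b l, 0 ≤ f c := by
    intro l hl b hb c hc
    by_contra! hneg
    obtain ⟨b', hb'⟩ := Set.mem_iUnion.1 hl.1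
    have hbb : b = b' := by
      by_contra h
      have := hb'.1.1.1 b h
      linarith
    subst hbb
    have ht : 0 < (|u| + 1) / -f c := div_pos (by positivity) (neg_pos.2 hneg)
    have h := hu l hl b hb _ (WitnessCone_smul hb'.1.1 hb hc ht)
    rw [map_smul, smul_eq_mul, div_mul_eq_mul_div, div_neg, mul_div_cancel_right₀ _ hneg.ne] at h
    linarith [neg_abs_le u]
  obtain ⟨l, hl⟩ := LambdaStar_nonempty hX hLI hΛ
  obtain ⟨b, hb⟩ := Set.mem_iUnion.1 hl.1
  have hu0 : u < 0 := by
    simpa using hu l hl b hb.2 0 (nonneg_mem_WitnessCone b fun _ => le_rfl)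
  have hf : ∀ z, f z = coeffPairing (fun i => f (Pi.single i 1)) z :=
    fun z => DFunLike.congr_fun (eq_coeffPairing f) z
  have hv : ∀ i, 0 ≤ f (Pi.single i 1) := fun i => hnn l hl b hb.2 _
    (nonneg_mem_WitnessCone b (single_one_nonneg i))
  have h := coeffPairing_nonneg_of_nonneg_WitnessCone hX hXcv hLI hv
    (fun l hl b hb c hc => hf c ▸ hnn l hl b hb c hc) hc
  rw [← hf] at h
  linarith

end Signomials

theorem statement9 {n m : ℕ} (X : Set (Fin n → ℝ)) (hXne : X.Nonempty) (hXcl : IsClosed X)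
    (hXcv : Convex ℝ X) (A : Fin m → Fin n → ℝ) (hA : Function.Injective A) (hm : 0 < m)
    (hLI : ExpLinIndep X A) :
    (Lambda X A = ∅ → Sage X A = {c : Fin m → ℝ | ∀ i, 0 ≤ c i}) ∧
    (Lambda X A ≠ ∅ →
      Sage X A = closure (convexHull ℝ (⋃ l ∈ LambdaStar X A, WitnessConeL X A l))) := by
  refine ⟨Sage_eq_nonneg_of_Lambda_eq_empty hXne hXcv hm hLI, fun hΛ => ?_⟩
  refine Set.Subset.antisymm
    (Sage_subset_closure hXne hXcv hLI (Set.nonempty_iff_ne_empty.2 hΛ)) ?_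
  have hS := isClosedCone_Sage hLI
  exact closure_minimal
    (convexHull_min (iUnion_WitnessConeL_subset_Sage hXne) hS.convex) hS.closed
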